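/- For simple random walk on ℤ^d with d ≥ 3, there exists ε > 0 such that, uniformly over the starting point z ∈ ℤ^d and over L_0 ≥ 1, the exponential moment E_z[ exp( ε Σ_{i≥0} τ_i / (L_i² · 3^i) ) ] is finite, where τ_i is the total time spent by the walk in the shell 𝓢_i. -/

import Mathlib

open MeasureTheory ENNReal

/-! Uniform exponential moment of the weighted occupation times of the
hierarchical shells `𝓢_i` by a simple random walk on `ℤ^d`, `d ≥ 3`. -/

/-- `ℓ∞`-norm of a lattice point, as a natural number. -/
def nsup {d : ℕ} (x : Fin d → ℤ) : ℕ := Finset.univ.sup fun i => (x i).natAbs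

/-- `ℓ¹`-distance. -/
def l1dist {d : ℕ} (x y : Fin d → ℤ) : ℕ := ∑ i, (x i - y i).natAbs

/-- `L_i = L₀ · 6^i`. -/
def Lnum (L₀ i : ℕ) : ℕ := L₀ * 6 ^ i

/-- `ℓ∞`-ball `Q(z,r)`. -/
def Qbox {d : ℕ} (z : Fin d → ℤ) (r : ℕ) : Set (Fin d → ℤ) := {y | nsup (y - z) ≤ r}

/-- `𝓜` is a proper embedding of the binary tree `T_n` into `ℤ^d` with root at `x`. -/
def ProperEmbedding (d L₀ n : ℕ) (x : Fin d → ℤ) (𝓜 : List (Fin 2) → (Fin d → ℤ)) : Prop :=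
  𝓜 [] = x ∧
  (∀ m : List (Fin 2), m.length ≤ n →
    ∀ i : Fin d, ((Lnum L₀ (n - m.length) : ℤ)) ∣ 𝓜 m i) ∧
  (∀ m : List (Fin 2), m.length < n →
    nsup (𝓜 (m ++ [0]) - 𝓜 m) = Lnum L₀ (n - m.length) ∧
    nsup (𝓜 (m ++ [1]) - 𝓜 m) = 2 * Lnum L₀ (n - m.length))

/-- The shells `𝓢_i`: `𝓢_0` is the union of boxes of radius `L_1` around the leaf
centers; for `1 ≤ i ≤ n`, `𝓢_i` is the union of boxes of radius `L_{i+1}` around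
the generation-`(n-i)` centers, minus `𝓢_{i-1}`; for `i > n`, `𝓢_i = Q(x,L_{i+1}) \ Q(x,L_i)`. -/
def shell (d L₀ n : ℕ) (𝓜 : List (Fin 2) → (Fin d → ℤ)) (x : Fin d → ℤ) :
    ℕ → Set (Fin d → ℤ)
  | 0 => ⋃ m ∈ {l : List (Fin 2) | l.length = n}, Qbox (𝓜 m) (Lnum L₀ 1)
  | (i + 1) =>
    if i + 1 ≤ n then
      (⋃ m ∈ {l : List (Fin 2) | l.length = n - (i + 1)}, Qbox (𝓜 m) (Lnum L₀ (i + 2)))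
        \ shell d L₀ n 𝓜 x i
    else Qbox x (Lnum L₀ (i + 2)) \ Qbox x (Lnum L₀ (i + 1))

/-- `(S_k)` is a simple random walk started at `z` under `P`. -/
def IsSRW {d : ℕ} {Ω : Type*} [MeasurableSpace Ω] (P : Measure Ω)
    (z : Fin d → ℤ) (S : ℕ → Ω → (Fin d → ℤ)) : Prop :=
  ∀ (n : ℕ) (γ : ℕ → (Fin d → ℤ)),
    P {ω | ∀ k ≤ n, S k ω = γ k} =
      if γ 0 = z ∧ ∀ k < n, l1dist (γ (k + 1)) (γ k) = 1
      then ((1 : ℝ≥0∞) / (2 * d)) ^ n else 0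

/-- Time spent by the walk in a set `A`. -/
noncomputable def occTime {d : ℕ} {Ω : Type*} (S : ℕ → Ω → (Fin d → ℤ))
    (A : Set (Fin d → ℤ)) (ω : Ω) : ℝ≥0∞ :=
  ∑' n : ℕ, A.indicator (fun _ => (1 : ℝ≥0∞)) (S n ω)

/-- `exp` on `ℝ≥0∞`. -/
noncomputable def eexp (t : ℝ≥0∞) : ℝ≥0∞ :=
  if t = ⊤ then ⊤ else ENNReal.ofReal (Real.exp t.toReal)


/-! ### Probabilistic part -/

/-- Averaging operator of the simple random walk. -/
noncomputable def avgOp {d : ℕ} (f : (Fin d → ℤ) → ℝ≥0∞) (x : Fin d → ℤ) : ℝ≥0∞ :=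
  (1 / (2 * d)) * ∑' y, if l1dist y x = 1 then f y else 0

theorem eexp_eq (t : ℝ≥0∞) : eexp t = EReal.exp (t : EReal) := by
  unfold eexp
  split_ifs with h
  · simp [h]
  · lift t to NNReal using h
    rw [show (((t : ℝ≥0∞) : EReal)) = ((t : ℝ) : EReal) from rfl, EReal.exp_coe]
    simp

theorem eexp_add (s t : ℝ≥0∞) : eexp (s + t) = eexp s * eexp t := by
  simp only [eexp_eq, EReal.coe_ennreal_add, EReal.exp_add]

theorem eexp_mono : Monotone eexp := by
  intro s t h
  simp only [eexp_eq]
  exact EReal.exp_monotone (EReal.coe_ennreal_le_coe_ennreal_iff.2 h)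

theorem eexp_continuous : Continuous eexp := by
  have : eexp = fun t : ℝ≥0∞ => EReal.exp (t : EReal) := funext eexp_eq
  rw [this]
  exact ENNReal.continuous_exp.comp continuous_coe_ennreal_ereal

theorem nullMeas_of_add_le {Ω : Type*} [MeasurableSpace Ω] (P : Measure Ω)
    [IsProbabilityMeasure P] (s : Set Ω) (h : P s + P sᶜ ≤ 1) : NullMeasurableSet s P := by
  set T := toMeasurable P s
  set U := toMeasurable P sᶜ
  have hT : MeasurableSet T := measurableSet_toMeasurable _ _
  have hU : MeasurableSet U := measurableSet_toMeasurable _ _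
  have hTU : T ∪ U = Set.univ := by
    rw [Set.eq_univ_iff_forall]
    intro x
    by_cases hx : x ∈ s
    · exact Or.inl (subset_toMeasurable P s hx)
    · exact Or.inr (subset_toMeasurable P sᶜ hx)
  have h1 : P (T ∪ U) + P (T ∩ U) = P T + P U := measure_union_add_inter T hU
  rw [hTU, measure_univ, measure_toMeasurable, measure_toMeasurable] at h1
  have h2 : P (T ∩ U) = 0 := by
    rw [← h1] at h
    have h3 : 1 + P (T ∩ U) ≤ 1 + 0 := by simpa using h
    exact le_antisymm ((ENNReal.add_le_add_iff_left ENNReal.one_ne_top).1 h3) zero_le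
  have h4 : s =ᵐ[P] T := by
    have h5 : ∀ᵐ x ∂P, x ∉ T ∩ U := measure_eq_zero_iff_ae_notMem.1 h2
    filter_upwards [h5] with x hx
    apply propext
    constructor
    · intro h; exact subset_toMeasurable P s h
    · intro h
      by_contra hs
      exact hx ⟨h, subset_toMeasurable P sᶜ hs⟩
  exact hT.nullMeasurableSet.congr h4.symm

/-- Cylinder event. -/
def cyl {d : ℕ} {Ω : Type*} (S : ℕ → Ω → (Fin d → ℤ)) (n : ℕ) (γ : ℕ → (Fin d → ℤ)) : Set Ω :=
  {ω | ∀ k ≤ n, S k ω = γ k}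

theorem cyl_split {d : ℕ} {Ω : Type*} (S : ℕ → Ω → (Fin d → ℤ)) (n : ℕ)
    (γ : ℕ → (Fin d → ℤ)) :
    cyl S n γ = ⋃ y, cyl S (n + 1) (Function.update γ (n + 1) y) := by
  ext ω
  simp only [cyl, Set.mem_ofPred_eq, Set.mem_iUnion]
  constructor
  · intro h
    refine ⟨S (n + 1) ω, fun k hk => ?_⟩
    rcases eq_or_ne k (n + 1) with rfl | hne
    · simp
    · rw [Function.update_of_ne hne]; exact h k (by omega)
  · rintro ⟨y, h⟩ k hk
    have := h k (by omega)
    rwa [Function.update_of_ne (by omega)] at this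

theorem cyl_prob_succ {d : ℕ} {Ω : Type*} [MeasurableSpace Ω] {P : Measure Ω}
    {z : Fin d → ℤ} {S : ℕ → Ω → (Fin d → ℤ)} (h : IsSRW P z S) (n : ℕ)
    (γ : ℕ → (Fin d → ℤ)) (y : Fin d → ℤ) :
    P (cyl S (n + 1) (Function.update γ (n + 1) y)) =
      P (cyl S n γ) * ((1 / (2 * d)) * if l1dist y (γ n) = 1 then 1 else 0) := by
  have h1 := h (n + 1) (Function.update γ (n + 1) y)
  have h2 := h n γ
  unfold cyl
  rw [h1, h2]
  have e : (Function.update γ (n + 1) y 0 = z ∧ ∀ k < n + 1,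
      l1dist (Function.update γ (n + 1) y (k + 1)) (Function.update γ (n + 1) y k) = 1) ↔
      ((γ 0 = z ∧ ∀ k < n, l1dist (γ (k + 1)) (γ k) = 1) ∧ l1dist y (γ n) = 1) := by
    rw [Function.update_of_ne (by omega)]
    rw [and_assoc]
    refine and_congr_right fun _ => ?_
    constructor
    · intro h
      refine ⟨fun k hk => ?_, ?_⟩
      · have := h k (by omega)
        rwa [Function.update_of_ne (by omega), Function.update_of_ne (by omega)] at this
      · have := h n (by omega)
        rwa [Function.update_self, Function.update_of_ne (by omega)] at this
    · rintro ⟨h, h'⟩ k hk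
      rcases eq_or_ne k n with rfl | hne
      · rwa [Function.update_self, Function.update_of_ne (by omega)]
      · rw [Function.update_of_ne (by omega), Function.update_of_ne (by omega)]
        exact h k (by omega)
  by_cases ha : (γ 0 = z ∧ ∀ k < n, l1dist (γ (k + 1)) (γ k) = 1)
  · by_cases hb : l1dist y (γ n) = 1
    · rw [if_pos (e.2 ⟨ha, hb⟩), if_pos ha, if_pos hb, mul_one, pow_succ]
    · rw [if_neg (fun hh => hb (e.1 hh).2), if_neg hb, mul_zero, mul_zero]
  · rw [if_neg (fun hh => ha (e.1 hh).1), if_neg ha, zero_mul]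

theorem tsum_cyl_mul {d : ℕ} {Ω : Type*} [MeasurableSpace Ω] {P : Measure Ω}
    {z : Fin d → ℤ} {S : ℕ → Ω → (Fin d → ℤ)} (h : IsSRW P z S) (n : ℕ)
    (γ : ℕ → (Fin d → ℤ)) (f : (Fin d → ℤ) → ℝ≥0∞) :
    ∑' y, P (cyl S (n + 1) (Function.update γ (n + 1) y)) * f y =
      P (cyl S n γ) * avgOp f (γ n) := by
  unfold avgOp
  rw [← ENNReal.tsum_mul_left, ← ENNReal.tsum_mul_left]
  refine tsum_congr fun y => ?_
  rw [cyl_prob_succ h]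
  split_ifs <;> ring

theorem cyl_zero_compl {d : ℕ} {Ω : Type*} [MeasurableSpace Ω] {P : Measure Ω}
    {z : Fin d → ℤ} {S : ℕ → Ω → (Fin d → ℤ)} (h : IsSRW P z S) :
    P {ω | S 0 ω ≠ z} = 0 := by
  have : {ω | S 0 ω ≠ z} ⊆ ⋃ y : {y : Fin d → ℤ // y ≠ z}, cyl S 0 (fun _ => y.1) := by
    intro ω hω
    simp only [Set.mem_iUnion, cyl]
    refine ⟨⟨S 0 ω, hω⟩, ?_⟩
    intro k hk
    obtain rfl : k = 0 := by omega
    rfl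
  refine measure_mono_null this (measure_iUnion_null fun y => ?_)
  have := h 0 (fun _ => y.1)
  unfold cyl
  rw [this, if_neg]
  exact fun hh => y.2 hh.1

theorem cyl_add_compl {d : ℕ} {Ω : Type*} [MeasurableSpace Ω] {P : Measure Ω}
    [IsProbabilityMeasure P]
    {z : Fin d → ℤ} {S : ℕ → Ω → (Fin d → ℤ)} (h : IsSRW P z S)
    (h1 : ∀ x : Fin d → ℤ, avgOp (fun _ => 1) x = 1) (n : ℕ) :
    ∀ (γ : ℕ → (Fin d → ℤ)), P (cyl S n γ) + P (cyl S n γ)ᶜ ≤ 1 := by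
  induction n with
  | zero =>
    intro γ
    by_cases hz : γ 0 = z
    · have : (cyl S 0 γ)ᶜ ⊆ {ω | S 0 ω ≠ z} := by
        intro ω hω h0
        apply hω
        intro k hk
        obtain rfl : k = 0 := by omega
        rw [h0, hz]
      rw [measure_mono_null this (cyl_zero_compl h), add_zero]
      exact prob_le_one
    · have : P (cyl S 0 γ) = 0 := by
        have := h 0 γ
        unfold cyl
        rw [this, if_neg (fun hh => hz hh.1)]
      rw [this, zero_add]
      exact prob_le_one
  | succ n ih =>
    intro γ
    classical
    set A : (Fin d → ℤ) → Set Ω := fun y => cyl S (n + 1) (Function.update γ (n + 1) y)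
    have hsub : (cyl S (n + 1) γ)ᶜ ⊆ (cyl S n γ)ᶜ ∪ ⋃ y, (if y = γ (n + 1) then ∅ else A y) := by
      intro ω hω
      by_cases hc : ω ∈ cyl S n γ
      · right
        rw [cyl_split] at hc
        obtain ⟨y, hy⟩ := Set.mem_iUnion.1 hc
        refine Set.mem_iUnion.2 ⟨y, ?_⟩
        rw [if_neg]
        · exact hy
        · rintro rfl
          rw [Function.update_eq_self] at hy
          exact hω hy
      · exact Or.inl hc
    have hA : cyl S (n + 1) γ = A (γ (n + 1)) := by
      simp only [A, Function.update_eq_self]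
    have hsum : P (A (γ (n + 1))) + ∑' y, (if y = γ (n + 1) then 0 else P (A y)) =
        ∑' y, P (A y) := by
      rw [ENNReal.tsum_eq_add_tsum_ite (f := fun y => P (A y)) (γ (n + 1))]
      congr!
    calc P (cyl S (n + 1) γ) + P (cyl S (n + 1) γ)ᶜ
        ≤ P (A (γ (n + 1))) + (P (cyl S n γ)ᶜ + ∑' y, (if y = γ (n + 1) then 0 else P (A y))) := by
          rw [hA]
          rw [← hA]
          gcongr
          refine (measure_mono hsub).trans ((measure_union_le _ _).trans ?_)
          gcongr
          refine (measure_iUnion_le _).trans (ENNReal.tsum_le_tsum fun y => ?_)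
          split_ifs <;> simp
      _ = P (cyl S n γ)ᶜ + ∑' y, P (A y) := by rw [← hsum]; ring
      _ = P (cyl S n γ)ᶜ + P (cyl S n γ) := by
          have := tsum_cyl_mul h n γ (fun _ => 1)
          simp only [mul_one, h1] at this
          rw [this]
      _ ≤ 1 := by rw [add_comm]; exact ih γ

theorem cyl_nullMeas {d : ℕ} {Ω : Type*} [MeasurableSpace Ω] {P : Measure Ω}
    [IsProbabilityMeasure P]
    {z : Fin d → ℤ} {S : ℕ → Ω → (Fin d → ℤ)} (h : IsSRW P z S)
    (h1 : ∀ x : Fin d → ℤ, avgOp (fun _ => 1) x = 1) (n : ℕ) (γ : ℕ → (Fin d → ℤ)) :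
    NullMeasurableSet (cyl S n γ) P :=
  nullMeas_of_add_le P _ (cyl_add_compl h h1 n γ)

theorem level_nullMeas {d : ℕ} {Ω : Type*} [MeasurableSpace Ω] {P : Measure Ω}
    [IsProbabilityMeasure P]
    {z : Fin d → ℤ} {S : ℕ → Ω → (Fin d → ℤ)} (h : IsSRW P z S)
    (h1 : ∀ x : Fin d → ℤ, avgOp (fun _ => 1) x = 1) (n : ℕ) (y : Fin d → ℤ) :
    NullMeasurableSet {ω | S n ω = y} P := by
  have : {ω | S n ω = y} = ⋃ g : {g : Fin (n + 1) → (Fin d → ℤ) // g (Fin.last n) = y},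
      cyl S n (fun k => if hk : k < n + 1 then g.1 ⟨k, hk⟩ else 0) := by
    ext ω
    simp only [Set.mem_ofPred_eq, Set.mem_iUnion, cyl]
    constructor
    · intro hω
      refine ⟨⟨fun k => S k ω, by simpa using hω⟩, ?_⟩
      intro k hk
      simp [Nat.lt_succ_of_le hk]
    · rintro ⟨g, hg⟩
      have := hg n le_rfl
      simp only [Nat.lt_succ_self, dite_true] at this
      rw [this]
      exact g.2
  rw [this]
  exact NullMeasurableSet.iUnion fun g => cyl_nullMeas h h1 n _

theorem comp_aemeas {d : ℕ} {Ω : Type*} [MeasurableSpace Ω] {P : Measure Ω}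
    [IsProbabilityMeasure P]
    {z : Fin d → ℤ} {S : ℕ → Ω → (Fin d → ℤ)} (h : IsSRW P z S)
    (h1 : ∀ x : Fin d → ℤ, avgOp (fun _ => 1) x = 1) (n : ℕ) (f : (Fin d → ℤ) → ℝ≥0∞) :
    AEMeasurable (fun ω => f (S n ω)) P := by
  apply MeasureTheory.NullMeasurable.aemeasurable
  intro s _
  have : (fun ω => f (S n ω)) ⁻¹' s = ⋃ y : {y : Fin d → ℤ // f y ∈ s}, {ω | S n ω = y.1} := by
    ext ω
    simp
  rw [this]
  exact NullMeasurableSet.iUnion fun y => level_nullMeas h h1 n _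

/-- Supermartingale bound on a cylinder. -/
theorem cyl_bound {d : ℕ} {Ω : Type*} [MeasurableSpace Ω] {P : Measure Ω}
    [IsProbabilityMeasure P]
    {z : Fin d → ℤ} {S : ℕ → Ω → (Fin d → ℤ)} (hS : IsSRW P z S)
    (h1 : ∀ x : Fin d → ℤ, avgOp (fun _ => 1) x = 1)
    (W h : (Fin d → ℤ) → ℝ≥0∞) (hh : ∀ x, 1 ≤ h x)
    (hW : ∀ x, eexp (W x) * avgOp h x ≤ h x) (N : ℕ) :
    ∀ (M : ℕ) (γ : ℕ → (Fin d → ℤ)),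
      ∫⁻ ω in cyl S M γ, eexp (∑ k ∈ Finset.range N, W (S (M + k) ω)) ∂P
        ≤ P (cyl S M γ) * h (γ M) := by
  induction N with
  | zero =>
    intro M γ
    have : eexp 0 = 1 := by simp [eexp]
    simp only [Finset.range_zero, Finset.sum_empty, this, lintegral_one, Measure.restrict_apply,
      MeasurableSet.univ, Set.univ_inter]
    exact le_mul_of_one_le_right zero_le (hh _)
  | succ N ih =>
    intro M γ
    have e1 : ∫⁻ ω in cyl S M γ, eexp (∑ k ∈ Finset.range (N + 1), W (S (M + k) ω)) ∂P
        = ∫⁻ ω in cyl S M γ, eexp (W (γ M)) *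
            eexp (∑ k ∈ Finset.range N, W (S (M + 1 + k) ω)) ∂P := by
      refine lintegral_congr_ae ?_
      filter_upwards [ae_restrict_mem₀ (cyl_nullMeas hS h1 M γ)] with ω hω
      rw [Finset.sum_range_succ', add_comm, eexp_add]
      have : S (M + 0) ω = γ M := hω M le_rfl
      rw [this]
      congr 3
      funext k
      rw [add_right_comm, add_assoc M k 1]
    have hm : AEMeasurable (fun ω => eexp (∑ k ∈ Finset.range N, W (S (M + 1 + k) ω)))
        (P.restrict (cyl S M γ)) := by
      refine AEMeasurable.mono_measure ?_ Measure.restrict_le_self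
      exact eexp_continuous.measurable.comp_aemeasurable
        (Finset.aemeasurable_fun_sum _ fun k _ => comp_aemeas hS h1 _ W)
    rw [e1, lintegral_const_mul'' _ hm]
    calc eexp (W (γ M)) * ∫⁻ ω in cyl S M γ, eexp (∑ k ∈ Finset.range N, W (S (M + 1 + k) ω)) ∂P
        ≤ eexp (W (γ M)) * ∑' y, P (cyl S (M + 1) (Function.update γ (M + 1) y)) * h y := by
          gcongr
          conv_lhs => rw [cyl_split]
          refine (lintegral_iUnion_le _ _).trans (ENNReal.tsum_le_tsum fun y => ?_)
          have := ih (M + 1) (Function.update γ (M + 1) y)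
          rwa [Function.update_self] at this
      _ = P (cyl S M γ) * (eexp (W (γ M)) * avgOp h (γ M)) := by
          rw [tsum_cyl_mul hS]; ring
      _ ≤ _ := by gcongr; exact hW _

theorem exp_bound {d : ℕ} {Ω : Type*} [MeasurableSpace Ω] {P : Measure Ω}
    [IsProbabilityMeasure P]
    {z : Fin d → ℤ} {S : ℕ → Ω → (Fin d → ℤ)} (hS : IsSRW P z S)
    (h1 : ∀ x : Fin d → ℤ, avgOp (fun _ => 1) x = 1)
    (W h : (Fin d → ℤ) → ℝ≥0∞) (hh : ∀ x, 1 ≤ h x)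
    (hW : ∀ x, eexp (W x) * avgOp h x ≤ h x) :
    ∫⁻ ω, eexp (∑' k, W (S k ω)) ∂P ≤ h z := by
  have hN : ∀ N : ℕ, ∫⁻ ω, eexp (∑ k ∈ Finset.range N, W (S k ω)) ∂P ≤ h z := by
    intro N
    have := cyl_bound hS h1 W h hh hW N 0 (fun _ => z)
    have hae : P.restrict (cyl S 0 fun _ => z) = P := by
      apply Measure.restrict_eq_self_of_ae_mem
      have h0 := cyl_zero_compl hS
      have : ∀ᵐ ω ∂P, ω ∉ {ω | S 0 ω ≠ z} := measure_eq_zero_iff_ae_notMem.1 h0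
      filter_upwards [this] with ω hω
      intro k hk
      obtain rfl : k = 0 := by omega
      simpa using hω
    rw [hae] at this
    simp only [zero_add] at this
    refine this.trans ?_
    calc _ ≤ 1 * h z := by gcongr; exact prob_le_one
      _ = h z := one_mul _
  have hlim : ∀ ω, eexp (∑' k, W (S k ω)) =
      ⨆ N, eexp (∑ k ∈ Finset.range N, W (S k ω)) := by
    intro ω
    have hmono : Monotone fun N => eexp (∑ k ∈ Finset.range N, W (S k ω)) := by
      intro a b hab
      exact eexp_mono (Finset.sum_le_sum_of_subset (Finset.range_mono hab))
    exact tendsto_nhds_unique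
      ((eexp_continuous.tendsto _).comp (ENNReal.summable.hasSum.tendsto_sum_nat))
      (tendsto_atTop_iSup hmono)
  simp_rw [hlim]
  rw [lintegral_iSup']
  · exact iSup_le hN
  · intro N
    exact eexp_continuous.measurable.comp_aemeasurable
        (Finset.aemeasurable_fun_sum _ fun k _ => comp_aemeas hS h1 _ W)
  · refine Filter.Eventually.of_forall fun ω => ?_
    intro a b hab
    exact eexp_mono (Finset.sum_le_sum_of_subset (Finset.range_mono hab))

/-! ### Neighbours on the lattice -/

/-- The signed unit step. -/
def stepv {d : ℕ} (p : Fin d × Bool) : Fin d → ℤ :=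
  Pi.single p.1 (if p.2 then 1 else -1)

theorem stepv_apply {d : ℕ} (p : Fin d × Bool) (j : Fin d) :
    stepv p j = if j = p.1 then (if p.2 then 1 else -1) else 0 := by
  unfold stepv
  rw [Pi.single_apply]

theorem stepv_inj {d : ℕ} : Function.Injective (stepv (d := d)) := by
  rintro ⟨i, a⟩ ⟨j, b⟩ h
  have h1 := congrFun h i
  simp only [stepv_apply] at h1
  by_cases hij : i = j
  · subst hij
    cases a <;> cases b <;> simp_all
  · cases a <;> simp [hij] at h1

theorem l1dist_step {d : ℕ} (x : Fin d → ℤ) (p : Fin d × Bool) :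
    l1dist (x + stepv p) x = 1 := by
  unfold l1dist
  rw [Finset.sum_eq_single p.1]
  · simp only [Pi.add_apply, stepv_apply]
    cases p.2 <;> simp
  · intro j _ hj
    simp [stepv_apply, hj]
  · simp

theorem exists_step {d : ℕ} (x y : Fin d → ℤ) (h : l1dist y x = 1) :
    ∃ p, x + stepv p = y := by
  unfold l1dist at h
  obtain ⟨i, hi⟩ : ∃ i, (y i - x i).natAbs ≠ 0 := by
    by_contra hc
    push Not at hc
    rw [Finset.sum_eq_zero fun i _ => hc i] at h
    omega
  rw [← Finset.add_sum_erase _ _ (Finset.mem_univ i)] at h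
  have h0 : ∑ j ∈ Finset.univ.erase i, (y j - x j).natAbs = 0 := by omega
  have h1 : (y i - x i).natAbs = 1 := by omega
  rw [Finset.sum_eq_zero_iff] at h0
  refine ⟨(i, decide (y i - x i = 1)), ?_⟩
  funext j
  simp only [Pi.add_apply, stepv_apply]
  by_cases hj : j = i
  · subst hj
    by_cases h2 : y j - x j = 1
    · simp [h2]; omega
    · simp [h2]; omega
  · have := h0 j (by simp [hj])
    simp [hj]; omega

theorem avgOp_eq {d : ℕ} (f : (Fin d → ℤ) → ℝ≥0∞) (x : Fin d → ℤ) :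
    avgOp f x = (1 / (2 * d)) * ∑ p : Fin d × Bool, f (x + stepv p) := by
  unfold avgOp
  congr 1
  have hinj : Function.Injective (fun p : Fin d × Bool => x + stepv p) :=
    (add_right_injective x).comp stepv_inj
  rw [← hinj.tsum_eq, tsum_fintype]
  · simp [l1dist_step]
  · intro y hy
    have : l1dist y x = 1 := by
      by_contra hc
      simp [hc] at hy
    obtain ⟨p, hp⟩ := exists_step x y this
    exact ⟨p, hp⟩

theorem avgOp_one {d : ℕ} (hd : 3 ≤ d) (x : Fin d → ℤ) : avgOp (fun _ => 1) x = 1 := by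
  rw [avgOp_eq]
  simp only [Finset.sum_const, Finset.card_univ, Fintype.card_prod, Fintype.card_fin,
    Fintype.card_bool, nsmul_eq_mul, mul_one, one_div]
  have : ((d * 2 : ℕ) : ℝ≥0∞) = 2 * d := by push_cast; ring
  rw [this]
  refine ENNReal.inv_mul_cancel ?_ ?_
  · simp; omega
  · exact ENNReal.mul_ne_top (by simp) (by simp)

theorem avgOp_tsum {d : ℕ} {ι : Type*} (f : ι → (Fin d → ℤ) → ℝ≥0∞) (x : Fin d → ℤ) :
    avgOp (fun y => ∑' i, f i y) x = ∑' i, avgOp (f i) x := by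
  unfold avgOp
  rw [ENNReal.tsum_mul_left, ENNReal.tsum_comm]
  congr 1
  refine tsum_congr fun y => ?_
  split_ifs <;> simp

theorem avgOp_const_mul {d : ℕ} (c : ℝ≥0∞) (f : (Fin d → ℤ) → ℝ≥0∞) (x : Fin d → ℤ) :
    avgOp (fun y => c * f y) x = c * avgOp f x := by
  simp only [avgOp_eq, ← Finset.mul_sum]
  ring

theorem avgOp_add {d : ℕ} (f g : (Fin d → ℤ) → ℝ≥0∞) (x : Fin d → ℤ) :
    avgOp (fun y => f y + g y) x = avgOp f x + avgOp g x := by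
  simp only [avgOp_eq, Finset.sum_add_distrib, mul_add]

/-! ### The explicit superharmonic function -/

/-- Squared Euclidean norm. -/
noncomputable def nsq {d : ℕ} (v : Fin d → ℤ) : ℝ := ∑ i, ((v i : ℤ) : ℝ) ^ 2

theorem nsq_nonneg {d : ℕ} (v : Fin d → ℤ) : 0 ≤ nsq v :=
  Finset.sum_nonneg fun _ _ => sq_nonneg _

/-- `(R² / (R² + |v|²))^{1/4}`. -/
noncomputable def wt {d : ℕ} (R : ℝ) (v : Fin d → ℤ) : ℝ :=
  Real.sqrt (Real.sqrt (R ^ 2 / (R ^ 2 + nsq v)))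

theorem wt_nonneg {d : ℕ} (R : ℝ) (v : Fin d → ℤ) : 0 ≤ wt R v := Real.sqrt_nonneg _

theorem wt_pow {d : ℕ} (R : ℝ) (v : Fin d → ℤ) :
    wt R v ^ 4 = R ^ 2 / (R ^ 2 + nsq v) := by
  unfold wt
  have h : 0 ≤ R ^ 2 / (R ^ 2 + nsq v) := by
    have := nsq_nonneg v
    positivity
  rw [show (4 : ℕ) = 2 * 2 from rfl, pow_mul, Real.sq_sqrt (Real.sqrt_nonneg _), Real.sq_sqrt h]

theorem wt_le_one {d : ℕ} (R : ℝ) (v : Fin d → ℤ) : wt R v ≤ 1 := by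
  have h : wt R v ^ 4 ≤ 1 ^ 4 := by
    rw [wt_pow, one_pow]
    have := nsq_nonneg v
    exact div_le_one_of_le₀ (by linarith) (by positivity)
  exact le_of_pow_le_pow_left₀ (by norm_num) zero_le_one h

theorem poly_ineq (t : ℝ) (h1 : -(1 / 20) ≤ t) (h2 : t ≤ 1 / 20) :
    1 ≤ (1 + t) * (1 - t / 4 + 11 / 64 * t ^ 2) ^ 4 := by
  have hp : 0 ≤ 1 - t / 4 + 11 / 64 * t ^ 2 := by nlinarith [sq_nonneg t]
  set p : ℝ := 1 - t / 4 + 11 / 64 * t ^ 2 with hpdef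
  have h3 : 0 ≤ t ^ 2 * (1 / 20 - t) := mul_nonneg (sq_nonneg t) (by linarith)
  have h4 : 0 ≤ t ^ 2 * (1 / 20 + t) := mul_nonneg (sq_nonneg t) (by linarith)
  have h5 : 0 ≤ t ^ 2 * t ^ 2 := by positivity
  have hs : 1 - t / 2 + 2 / 5 * t ^ 2 ≤ p ^ 2 := by
    rw [hpdef]; nlinarith
  have hs0 : 0 ≤ 1 - t / 2 + 2 / 5 * t ^ 2 := by nlinarith [sq_nonneg t]
  have hr : 1 - t + 21 / 20 * t ^ 2 - 2 / 5 * t ^ 3 ≤ p ^ 4 := by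
    calc 1 - t + 21 / 20 * t ^ 2 - 2 / 5 * t ^ 3 ≤ (1 - t / 2 + 2 / 5 * t ^ 2) ^ 2 := by nlinarith
      _ ≤ (p ^ 2) ^ 2 := pow_le_pow_left₀ hs0 hs 2
      _ = p ^ 4 := by ring
  have h6 : t ^ 2 * t ^ 2 ≤ t ^ 2 * (1 / 400) :=
    mul_le_mul_of_nonneg_left (by nlinarith) (sq_nonneg t)
  calc (1 : ℝ) ≤ (1 + t) * (1 - t + 21 / 20 * t ^ 2 - 2 / 5 * t ^ 3) := by nlinarith [sq_nonneg t]
    _ ≤ (1 + t) * p ^ 4 := mul_le_mul_of_nonneg_left hr (by linarith)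

theorem nsq_step {d : ℕ} (v : Fin d → ℤ) (p : Fin d × Bool) :
    nsq (v + stepv p) = nsq v + (1 + 2 * (if p.2 then 1 else -1) * (v p.1 : ℝ)) := by
  unfold nsq
  have : ∀ i, (((v + stepv p) i : ℤ) : ℝ) ^ 2 = ((v i : ℤ) : ℝ) ^ 2 +
      (if i = p.1 then (1 + 2 * (if p.2 then 1 else -1) * (v p.1 : ℝ)) else 0) := by
    intro i
    simp only [Pi.add_apply, stepv_apply]
    by_cases h : i = p.1
    · subst h
      cases p.2 <;> simp <;> ring
    · simp [h]
  simp_rw [this, Finset.sum_add_distrib, Finset.sum_ite_eq' ]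
  simp

theorem wt_step {d : ℕ} (R : ℝ) (hR : 32 ≤ R) (v : Fin d → ℤ) (p : Fin d × Bool) (δ q : ℝ)
    (hq : q = R ^ 2 + nsq v) (hδ : δ = 1 + 2 * (if p.2 then 1 else -1) * (v p.1 : ℝ)) :
    wt R (v + stepv p) ≤ wt R v * (1 - (δ / q) / 4 + 11 / 64 * (δ / q) ^ 2) := by
  have hn := nsq_nonneg v
  have hq0 : 0 < q := by rw [hq]; positivity
  have hv : (v p.1 : ℝ) ^ 2 ≤ nsq v :=
    Finset.single_le_sum (f := fun i => ((v i : ℤ) : ℝ) ^ 2) (fun _ _ => sq_nonneg _)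
      (Finset.mem_univ p.1)
  set a : ℝ := (v p.1 : ℝ)
  have hs : |2 * (if p.2 then 1 else -1) * a| ≤ q / 32 := by
    have : |2 * (if p.2 then 1 else -1) * a| = 2 * |a| := by
      cases p.2 <;> simp [abs_mul]
    rw [this]
    have := sq_abs a
    nlinarith [sq_nonneg (R - |a|), abs_nonneg a]
  have h1q : 1 ≤ q / 1000 := by nlinarith
  obtain ⟨hs1, hs2⟩ := abs_le.1 hs
  have ht1 : -(1 / 20) ≤ δ / q := by
    rw [le_div_iff₀ hq0]; linarith
  have ht2 : δ / q ≤ 1 / 20 := by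
    rw [div_le_iff₀ hq0]; linarith
  have hpoly := poly_ineq _ ht1 ht2
  have hp : 0 ≤ 1 - (δ / q) / 4 + 11 / 64 * (δ / q) ^ 2 := by nlinarith [sq_nonneg (δ / q)]
  refine le_of_pow_le_pow_left₀ (n := 4) (by norm_num) (mul_nonneg (wt_nonneg _ _) hp) ?_
  rw [mul_pow, wt_pow, wt_pow, nsq_step, ← hδ, ← add_assoc, ← hq]
  have hqd : q + δ = q * (1 + δ / q) := by field_simp
  have hpos : 0 < 1 + δ / q := by linarith
  rw [hqd, div_le_iff₀ (by positivity)]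
  have : R ^ 2 / q * (1 - δ / q / 4 + 11 / 64 * (δ / q) ^ 2) ^ 4 * (q * (1 + δ / q)) =
      R ^ 2 * ((1 + δ / q) * (1 - δ / q / 4 + 11 / 64 * (δ / q) ^ 2) ^ 4) := by
    field_simp
  rw [this]
  nlinarith [sq_nonneg R]

theorem wt_super {d : ℕ} (hd : 3 ≤ d) (R : ℝ) (hR : 32 ≤ R) (v : Fin d → ℤ) :
    ∑ p : Fin d × Bool, wt R (v + stepv p) ≤
      2 * d * (wt R v * (1 - 1 / (48 * (R ^ 2 + nsq v)))) := by
  have hn := nsq_nonneg v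
  set q : ℝ := R ^ 2 + nsq v with hq
  have hq0 : 0 < q := by positivity
  have hd' : (3 : ℝ) ≤ d := by exact_mod_cast hd
  calc ∑ p : Fin d × Bool, wt R (v + stepv p)
      ≤ ∑ p : Fin d × Bool, wt R v *
        (1 - ((1 + 2 * (if p.2 then 1 else -1) * (v p.1 : ℝ)) / q) / 4 + 11 / 64 *
          ((1 + 2 * (if p.2 then 1 else -1) * (v p.1 : ℝ)) / q) ^ 2) :=
        Finset.sum_le_sum fun p _ => wt_step R hR v p _ q hq rfl
    _ = ∑ i : Fin d, wt R v * (2 - 1 / (2 * q) + 11 / 32 * (1 / q ^ 2) +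
          11 / 8 * (1 / q ^ 2) * ((v i : ℤ) : ℝ) ^ 2) := by
        rw [Fintype.sum_prod_type]
        refine Finset.sum_congr rfl fun i _ => ?_
        simp
        ring
    _ = wt R v * (d * (2 - 1 / (2 * q) + 11 / 32 * (1 / q ^ 2)) +
          11 / 8 * (1 / q ^ 2) * nsq v) := by
        rw [← Finset.mul_sum, Finset.sum_add_distrib, ← Finset.mul_sum]
        simp only [nsq, Finset.sum_const, Finset.card_univ, Fintype.card_fin, nsmul_eq_mul]
    _ ≤ wt R v * (2 * d * (1 - 1 / (48 * q))) := by
        refine mul_le_mul_of_nonneg_left ?_ (wt_nonneg _ _)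
        have h1 : nsq v = q - R ^ 2 := by rw [hq]; ring
        have e : 2 * d * (1 - 1 / (48 * q)) - (d * (2 - 1 / (2 * q) + 11 / 32 * (1 / q ^ 2)) +
          11 / 8 * (1 / q ^ 2) * nsq v) =
          (d * (11 / 24) * q - d * (11 / 32) - 11 / 8 * nsq v) / q ^ 2 := by
          field_simp
          ring
        have : 0 ≤ (d * (11 / 24) * q - d * (11 / 32) - 11 / 8 * nsq v) / q ^ 2 := by
          apply div_nonneg _ (by positivity)
          rw [h1]
          nlinarith [mul_nonneg (sub_nonneg.2 hd') hq0.le, mul_nonneg (sub_nonneg.2 hd') (show (0:ℝ) ≤ q - 1 by nlinarith)]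
        linarith
    _ = _ := by ring

/-! ### Norm comparisons -/

theorem natAbs_le_nsup {d : ℕ} (v : Fin d → ℤ) (i : Fin d) : (v i).natAbs ≤ nsup v :=
  Finset.le_sup (f := fun i => (v i).natAbs) (Finset.mem_univ i)

theorem nsup_tri {d : ℕ} (a b c : Fin d → ℤ) : nsup (a - c) ≤ nsup (a - b) + nsup (b - c) := by
  refine Finset.sup_le fun i _ => ?_
  have h1 := natAbs_le_nsup (a - b) i
  have h2 := natAbs_le_nsup (b - c) i
  simp only [Pi.sub_apply] at *
  omega

theorem nsup_comm {d : ℕ} (a b : Fin d → ℤ) : nsup (a - b) = nsup (b - a) := by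
  unfold nsup
  congr 1
  funext i
  simp only [Pi.sub_apply]
  omega

theorem nsq_le {d : ℕ} (v : Fin d → ℤ) : nsq v ≤ d * (nsup v : ℝ) ^ 2 := by
  unfold nsq
  calc ∑ i, ((v i : ℤ) : ℝ) ^ 2 ≤ ∑ _i : Fin d, (nsup v : ℝ) ^ 2 := by
        refine Finset.sum_le_sum fun i _ => ?_
        have h := natAbs_le_nsup v i
        have h' : |((v i : ℤ) : ℝ)| ≤ nsup v := by
          rw [← Int.cast_abs, Int.abs_eq_natAbs]
          exact_mod_cast h
        rw [← sq_abs]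
        gcongr
    _ = _ := by simp

theorem le_nsq {d : ℕ} (hd : 3 ≤ d) (v : Fin d → ℤ) : (nsup v : ℝ) ^ 2 ≤ nsq v := by
  have : NeZero d := ⟨by omega⟩
  obtain ⟨i, _, hi⟩ := Finset.exists_mem_eq_sup (Finset.univ : Finset (Fin d))
    Finset.univ_nonempty (fun i => (v i).natAbs)
  have h1 : nsup v = (v i).natAbs := hi
  have h2 : (nsup v : ℝ) ^ 2 = ((v i : ℤ) : ℝ) ^ 2 := by
    rw [h1, ← sq_abs ((v i : ℤ) : ℝ), ← Int.cast_abs, Int.abs_eq_natAbs]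
    norm_cast
  rw [h2]
  exact Finset.single_le_sum (f := fun i => ((v i : ℤ) : ℝ) ^ 2) (fun _ _ => sq_nonneg _)
      (Finset.mem_univ i)

theorem wt_far {d : ℕ} (hd : 3 ≤ d) (L : ℕ) (hL : 1 ≤ L) (k : ℕ) (v : Fin d → ℤ)
    (h : L * 6 ^ k ≤ 10 * nsup v) : wt (32 * L) v ≤ 20 * (5 / 12) ^ k := by
  refine le_of_pow_le_pow_left₀ (n := 4) (by norm_num) (by positivity) ?_
  rw [wt_pow]
  have hn := nsq_nonneg v
  have hL' : (1 : ℝ) ≤ L := by exact_mod_cast hL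
  have h' : (L : ℝ) * 6 ^ k ≤ 10 * nsup v := by exact_mod_cast h
  have h2 : ((L : ℝ) * 6 ^ k) ^ 2 ≤ 100 * nsq v := by
    calc ((L : ℝ) * 6 ^ k) ^ 2 ≤ (10 * (nsup v : ℝ)) ^ 2 := by gcongr
      _ = 100 * (nsup v : ℝ) ^ 2 := by ring
      _ ≤ _ := by gcongr; exact le_nsq hd v
  rw [div_le_iff₀ (by positivity)]
  have h3 : (1 : ℝ) ≤ ((5 / 12) ^ k) ^ 4 * (6 ^ k) ^ 2 := by
    have : ((5 / 12 : ℝ) ^ k) ^ 4 * (6 ^ k) ^ 2 = (((5 : ℝ) / 12) ^ 4 * 6 ^ 2) ^ k := by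
      rw [mul_pow, ← pow_mul, ← pow_mul, ← pow_mul, ← pow_mul, mul_comm k 4, mul_comm k 2]
    rw [this]
    exact one_le_pow₀ (by norm_num)
  have h4 : 0 ≤ ((5 / 12 : ℝ) ^ k) ^ 4 := by positivity
  have h5 : (L : ℝ) ^ 2 ≤ ((5 / 12) ^ k) ^ 4 * ((L : ℝ) * 6 ^ k) ^ 2 := by
    rw [mul_pow]
    nlinarith [sq_nonneg (L : ℝ)]
  have h6 := mul_le_mul_of_nonneg_left h2 h4
  calc (32 * (L : ℝ)) ^ 2 = 1024 * (L : ℝ) ^ 2 := by ring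
    _ ≤ 1024 * (((5 / 12) ^ k) ^ 4 * (100 * nsq v)) := by linarith
    _ ≤ 160000 * (((5 / 12) ^ k) ^ 4 * nsq v) := by
        nlinarith [mul_nonneg h4 hn]
    _ ≤ 160000 * (((5 / 12) ^ k) ^ 4 * ((32 * (L : ℝ)) ^ 2 + nsq v)) := by
        gcongr
        nlinarith [sq_nonneg (L : ℝ)]
    _ = _ := by ring

/-- The constant in the drift bound. -/
noncomputable def kap (d : ℕ) : ℝ := 1024 / (48 * (1024 + 36 * d) ^ 2)

theorem kap_pos (d : ℕ) : 0 < kap d := by unfold kap; positivity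

theorem wt_near {d : ℕ} (L : ℕ) (hL : 1 ≤ L) (v : Fin d → ℤ) (h : nsup v ≤ 6 * L) :
    kap d / (L : ℝ) ^ 2 ≤ wt (32 * L) v * (1 / (48 * ((32 * L : ℝ) ^ 2 + nsq v))) := by
  have hn := nsq_nonneg v
  have hL' : (1 : ℝ) ≤ L := by exact_mod_cast hL
  have h' : (nsup v : ℝ) ≤ 6 * L := by exact_mod_cast h
  set q : ℝ := (32 * L : ℝ) ^ 2 + nsq v with hq
  have hq0 : 0 < q := by positivity
  have hqle : q ≤ (1024 + 36 * d) * (L : ℝ) ^ 2 := by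
    have := nsq_le v
    have h2 : (nsup v : ℝ) ^ 2 ≤ (6 * L) ^ 2 := by gcongr
    have h3 : (d : ℝ) * (nsup v : ℝ) ^ 2 ≤ d * (6 * L) ^ 2 := by gcongr
    rw [hq]
    nlinarith
  have hw : 1024 * (L : ℝ) ^ 2 / q ≤ wt (32 * L) v := by
    have h1 := wt_pow (32 * L : ℝ) v
    rw [← hq] at h1
    calc 1024 * (L : ℝ) ^ 2 / q = wt (32 * L) v ^ 4 := by rw [h1]; ring
      _ ≤ wt (32 * L) v := pow_le_of_le_one (wt_nonneg _ _) (wt_le_one _ _) (by norm_num)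
  calc kap d / (L : ℝ) ^ 2 = 1024 * (L : ℝ) ^ 2 / (48 * ((1024 + 36 * d) * (L : ℝ) ^ 2) ^ 2) := by
        unfold kap
        field_simp
    _ ≤ 1024 * (L : ℝ) ^ 2 / (48 * q ^ 2) := by gcongr
    _ = 1024 * (L : ℝ) ^ 2 / q * (1 / (48 * q)) := by field_simp
    _ ≤ _ := by gcongr

open Classical in
theorem drift {d : ℕ} (hd : 3 ≤ d) (L : ℕ) (hL : 1 ≤ L) (c y : Fin d → ℤ) :
    avgOp (fun y => ENNReal.ofReal (wt (32 * L) (y - c))) y +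
      (if y ∈ Qbox c (6 * L) then ENNReal.ofReal (kap d / (L : ℝ) ^ 2) else 0)
      ≤ ENNReal.ofReal (wt (32 * L) (y - c)) := by
  have hL' : (1 : ℝ) ≤ L := by exact_mod_cast hL
  set v := y - c with hv
  have hn := nsq_nonneg v
  set q : ℝ := (32 * L : ℝ) ^ 2 + nsq v with hq
  have hq1 : 1 ≤ q := by nlinarith
  have hqi : 1 / (48 * q) ≤ 1 := by
    rw [div_le_one (by positivity)]; linarith
  have hqi0 : 0 ≤ 1 / (48 * q) := by positivity
  have hA : avgOp (fun y => ENNReal.ofReal (wt (32 * L) (y - c))) y ≤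
      ENNReal.ofReal (wt (32 * L) v * (1 - 1 / (48 * q))) := by
    rw [avgOp_eq]
    have e : ∀ p : Fin d × Bool, y + stepv p - c = v + stepv p := by
      intro p; rw [hv]; abel
    simp_rw [e]
    rw [← ENNReal.ofReal_sum_of_nonneg (fun p _ => wt_nonneg _ _)]
    have hd0 : ((2 * d : ℝ≥0∞)) ≠ 0 := by simp; omega
    have hdt : ((2 * d : ℝ≥0∞)) ≠ ⊤ := ENNReal.mul_ne_top (by simp) (by simp)
    rw [one_div]
    rw [ENNReal.inv_mul_le_iff hd0 hdt]
    have := wt_super hd (32 * L) (by linarith) v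
    rw [← hq] at this
    refine (ENNReal.ofReal_le_ofReal this).trans ?_
    rw [ENNReal.ofReal_mul (by positivity), ENNReal.ofReal_mul (by positivity)]
    simp
  have hw := wt_nonneg (32 * L : ℝ) v
  refine (add_le_add_left hA _).trans ?_
  split_ifs with hy
  · rw [← ENNReal.ofReal_add (mul_nonneg hw (by linarith)) (by have := kap_pos d; positivity)]
    refine ENNReal.ofReal_le_ofReal ?_
    have := wt_near L hL v hy
    rw [← hq] at this
    linarith
  · rw [add_zero]
    refine ENNReal.ofReal_le_ofReal ?_
    nlinarith

/-! ### The tree -/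

theorem tsum_len_succ (k : ℕ) (φ : List (Fin 2) → ℝ≥0∞) :
    ∑' l : {l : List (Fin 2) // l.length = k + 1}, φ l.1 ≤
      ∑' l : {l : List (Fin 2) // l.length = k}, φ (0 :: l.1) +
      ∑' l : {l : List (Fin 2) // l.length = k}, φ (1 :: l.1) := by
  let g : Fin 2 × {l : List (Fin 2) // l.length = k} → {l : List (Fin 2) // l.length = k + 1} :=
    fun p => ⟨p.1 :: p.2.1, by simp [p.2.2]⟩
  have hg : Function.Surjective g := by
    rintro ⟨l, hl⟩
    cases l with
    | nil => simp at hl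
    | cons a l => exact ⟨(a, ⟨l, by simpa using hl⟩), rfl⟩
  refine (ENNReal.tsum_le_tsum_comp_of_surjective hg _).trans ?_
  have e := ENNReal.tsum_prod
    (f := fun (a : Fin 2) (l : {l : List (Fin 2) // l.length = k}) => φ (a :: l.1))
  refine e.le.trans ?_
  rw [tsum_fintype, Fin.sum_univ_two]

theorem tsum_len_zero (φ : List (Fin 2) → ℝ≥0∞) :
    ∑' l : {l : List (Fin 2) // l.length = 0}, φ l.1 ≤ φ [] := by
  rw [tsum_eq_single ⟨[], rfl⟩]
  rintro ⟨l, hl⟩ hne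
  exact absurd (Subtype.ext (List.length_eq_zero_iff.1 hl)) hne

theorem tsum_len_le (k : ℕ) : ∀ (φ : List (Fin 2) → ℝ≥0∞) (b : ℝ≥0∞),
    (∀ l, l.length = k → φ l ≤ b) →
    ∑' l : {l : List (Fin 2) // l.length = k}, φ l.1 ≤ 2 ^ k * b := by
  induction k with
  | zero =>
    intro φ b h
    refine (tsum_len_zero φ).trans ?_
    simpa using h [] rfl
  | succ k ih =>
    intro φ b h
    refine (tsum_len_succ k φ).trans ?_
    have h0 := ih (fun l => φ (0 :: l)) b fun l hl => h _ (by simp [hl])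
    have h1 := ih (fun l => φ (1 :: l)) b fun l hl => h _ (by simp [hl])
    refine (add_le_add h0 h1).trans (le_of_eq ?_)
    ring

theorem desc_bound {d L₀ n : ℕ} {x : Fin d → ℤ} {𝓜 : List (Fin 2) → (Fin d → ℤ)}
    (h : ProperEmbedding d L₀ n x 𝓜) (i k : ℕ) : ∀ (m l : List (Fin 2)), l.length = k →
      m.length + k + i = n → 5 * nsup (𝓜 (m ++ l) - 𝓜 m) ≤ 2 * Lnum L₀ (i + k + 1) := by
  induction k with
  | zero =>
    intro m l hl _
    rw [List.length_eq_zero_iff.1 hl]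
    have h0 : nsup (0 : Fin d → ℤ) = 0 :=
      Nat.le_zero.1 (Finset.sup_le fun i _ => by simp)
    simp [h0]
  | succ k ih =>
    intro m l hl hm
    cases l with
    | nil => simp at hl
    | cons a l =>
      have h1 := ih (m ++ [a]) l (by simpa using hl) (by simp; omega)
      have h2 := h.2.2 m (by omega)
      have h3 : nsup (𝓜 (m ++ [a]) - 𝓜 m) ≤ 2 * Lnum L₀ (i + k + 1) := by
        have e : n - m.length = i + k + 1 := by omega
        rw [e] at h2
        fin_cases a
        · simp only [Fin.zero_eta]; omega
        · simp only [Fin.mk_one]; omega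
      have h4 : m ++ a :: l = (m ++ [a]) ++ l := by simp
      rw [h4]
      have h5 := nsup_tri (𝓜 (m ++ [a] ++ l)) (𝓜 (m ++ [a])) (𝓜 m)
      have h6 : Lnum L₀ (i + (k + 1) + 1) = 6 * Lnum L₀ (i + k + 1) := by
        unfold Lnum; ring
      omega

theorem tree_bound {d L₀ n : ℕ} (hd : 3 ≤ d) (hL : 1 ≤ L₀) {x : Fin d → ℤ}
    {𝓜 : List (Fin 2) → (Fin d → ℤ)}
    (h : ProperEmbedding d L₀ n x 𝓜) (y : Fin d → ℤ) (i k : ℕ) : ∀ (m : List (Fin 2)),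
      m.length + k + i = n →
      ∑' l : {l : List (Fin 2) // l.length = k},
        ENNReal.ofReal (wt (32 * Lnum L₀ i) (y - 𝓜 (m ++ l.1))) ≤
        ENNReal.ofReal (1 + 50 * (1 - (5 / 6) ^ k)) := by
  have hLi : 1 ≤ Lnum L₀ i := by
    unfold Lnum
    exact Nat.mul_pos hL (by positivity)
  induction k with
  | zero =>
    intro m _
    refine (tsum_len_zero fun l =>
      ENNReal.ofReal (wt (32 * Lnum L₀ i) (y - 𝓜 (m ++ l)))).trans ?_
    refine ENNReal.ofReal_le_ofReal ?_
    simpa using wt_le_one _ _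
  | succ k ih =>
    intro m hm
    have hfar : ∀ a : Fin 2, Lnum L₀ (i + k + 1) ≤ 2 * nsup (y - 𝓜 (m ++ [a])) →
        ∑' l : {l : List (Fin 2) // l.length = k},
          ENNReal.ofReal (wt (32 * Lnum L₀ i) (y - 𝓜 (m ++ a :: l.1))) ≤
          ENNReal.ofReal (25 / 3 * (5 / 6) ^ k) := by
      intro a ha
      have hb := tsum_len_le k
        (fun l => ENNReal.ofReal (wt (32 * Lnum L₀ i) (y - 𝓜 (m ++ a :: l))))
        (ENNReal.ofReal (20 * (5 / 12) ^ (k + 1))) ?_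
      · refine hb.trans (le_of_eq ?_)
        have e2 : (2 : ℝ≥0∞) ^ k = ENNReal.ofReal (2 ^ k) := by
          rw [ENNReal.ofReal_pow (by norm_num)]; simp
        rw [e2, ← ENNReal.ofReal_mul (by positivity)]
        congr 1
        have : (5 / 6 : ℝ) ^ k = 2 ^ k * (5 / 12) ^ k := by rw [← mul_pow]; norm_num
        rw [this]; ring
      · intro l hl
        refine ENNReal.ofReal_le_ofReal (wt_far hd _ hLi (k + 1) _ ?_)
        have h1 := desc_bound h i k (m ++ [a]) l hl (by simp; omega)
        have h4 : m ++ a :: l = (m ++ [a]) ++ l := by simp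
        rw [h4]
        have h5 := nsup_tri y (𝓜 (m ++ [a] ++ l)) (𝓜 (m ++ [a]))
        have h6 : Lnum L₀ i * 6 ^ (k + 1) = Lnum L₀ (i + k + 1) := by
          unfold Lnum; ring
        rw [h6]
        omega
    have hnear : ∀ a : Fin 2, ∑' l : {l : List (Fin 2) // l.length = k},
          ENNReal.ofReal (wt (32 * Lnum L₀ i) (y - 𝓜 (m ++ a :: l.1))) ≤
          ENNReal.ofReal (1 + 50 * (1 - (5 / 6) ^ k)) := by
      intro a
      have := ih (m ++ [a]) (by simp; omega)
      simpa using this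
    refine (tsum_len_succ k fun l =>
      ENNReal.ofReal (wt (32 * Lnum L₀ i) (y - 𝓜 (m ++ l)))).trans ?_
    have hp : (5 / 6 : ℝ) ^ k ≤ 1 := pow_le_one₀ (by norm_num) (by norm_num)
    have hfin : ENNReal.ofReal (25 / 3 * (5 / 6) ^ k) +
        ENNReal.ofReal (1 + 50 * (1 - (5 / 6) ^ k)) =
        ENNReal.ofReal (1 + 50 * (1 - (5 / 6) ^ (k + 1))) := by
      rw [← ENNReal.ofReal_add (by positivity) (by linarith)]
      congr 1
      ring
    have hsep : Lnum L₀ (i + k + 1) ≤ 2 * nsup (y - 𝓜 (m ++ [0])) ∨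
        Lnum L₀ (i + k + 1) ≤ 2 * nsup (y - 𝓜 (m ++ [1])) := by
      have h2 := h.2.2 m (by omega)
      have e : n - m.length = i + k + 1 := by omega
      rw [e] at h2
      have h3 := nsup_tri (𝓜 (m ++ [1])) (𝓜 (m ++ [0])) (𝓜 m)
      have h4 := nsup_tri (𝓜 (m ++ [1])) y (𝓜 (m ++ [0]))
      have h5 := nsup_comm (𝓜 (m ++ [1])) y
      omega
    rw [← hfin]
    rcases hsep with hs | hs
    · exact add_le_add (hfar 0 hs) (hnear 1)
    · rw [add_comm]
      exact add_le_add (hfar 1 hs) (hnear 0)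

theorem tree_bound' {d L₀ n : ℕ} (hd : 3 ≤ d) (hL : 1 ≤ L₀) {x : Fin d → ℤ}
    {𝓜 : List (Fin 2) → (Fin d → ℤ)}
    (h : ProperEmbedding d L₀ n x 𝓜) (y : Fin d → ℤ) (i : ℕ) :
      ∑' l : {l : List (Fin 2) // l.length = n - i},
        ENNReal.ofReal (wt (32 * Lnum L₀ i) (y - 𝓜 l.1)) ≤ 51 := by
  have h51 : (51 : ℝ≥0∞) = ENNReal.ofReal 51 := by simp
  rcases le_or_gt i n with hi | hi
  · have := tree_bound hd hL h y i (n - i) [] (by simp; omega)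
    simp only [List.nil_append] at this
    refine this.trans ?_
    rw [h51]
    refine ENNReal.ofReal_le_ofReal ?_
    have : (0 : ℝ) ≤ (5 / 6) ^ (n - i) := by positivity
    linarith
  · have e : n - i = 0 := by omega
    rw [e]
    refine (tsum_len_zero fun l => ENNReal.ofReal (wt (32 * Lnum L₀ i) (y - 𝓜 l))).trans ?_
    rw [h51]
    refine ENNReal.ofReal_le_ofReal ?_
    have := wt_le_one (32 * Lnum L₀ i : ℝ) (y - 𝓜 [])
    linarith

theorem shell_sub {d L₀ n : ℕ} {x : Fin d → ℤ} {𝓜 : List (Fin 2) → (Fin d → ℤ)}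
    (h : ProperEmbedding d L₀ n x 𝓜) (i : ℕ) (y : Fin d → ℤ) (hy : y ∈ shell d L₀ n 𝓜 x i) :
    ∃ l : List (Fin 2), l.length = n - i ∧ y ∈ Qbox (𝓜 l) (6 * Lnum L₀ i) := by
  cases i with
  | zero =>
    simp only [shell, Set.mem_iUnion] at hy
    obtain ⟨m, hm, hy⟩ := hy
    refine ⟨m, hm, ?_⟩
    have : 6 * Lnum L₀ 0 = Lnum L₀ 1 := by unfold Lnum; ring
    rwa [this]
  | succ i =>
    have e : 6 * Lnum L₀ (i + 1) = Lnum L₀ (i + 2) := by unfold Lnum; ring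
    rw [e]
    unfold shell at hy
    split_ifs at hy with hi
    · have hy1 := hy.1
      simp only [Set.mem_iUnion] at hy1
      obtain ⟨m, hm, hy1⟩ := hy1
      exact ⟨m, hm, hy1⟩
    · refine ⟨[], by simp; omega, ?_⟩
      rw [h.1]
      exact hy.1

/-! ### Assembling -/

/-- The Lyapunov function. -/
noncomputable def lyap (d L₀ n : ℕ) (𝓜 : List (Fin 2) → (Fin d → ℤ)) (y : Fin d → ℤ) : ℝ≥0∞ :=
  1 + ∑' i : ℕ, ((3 : ℝ≥0∞) ^ i)⁻¹ * ∑' l : {l : List (Fin 2) // l.length = n - i},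
    ENNReal.ofReal (wt (32 * Lnum L₀ i) (y - 𝓜 l.1))

/-- The potential. -/
noncomputable def pot (d L₀ n : ℕ) (𝓜 : List (Fin 2) → (Fin d → ℤ)) (x y : Fin d → ℤ) : ℝ≥0∞ :=
  ∑' i : ℕ, (shell d L₀ n 𝓜 x i).indicator (fun _ => (1 : ℝ≥0∞)) y /
    ((Lnum L₀ i : ℝ≥0∞) ^ 2 * 3 ^ i)

theorem lyap_le {d L₀ n : ℕ} (hd : 3 ≤ d) (hL : 1 ≤ L₀) {x : Fin d → ℤ}
    {𝓜 : List (Fin 2) → (Fin d → ℤ)}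
    (h : ProperEmbedding d L₀ n x 𝓜) (y : Fin d → ℤ) : lyap d L₀ n 𝓜 y ≤ ENNReal.ofReal 103 := by
  unfold lyap
  calc _ ≤ 1 + ∑' i : ℕ, ((2 : ℝ≥0∞)⁻¹) ^ i * 51 := by
        gcongr with i
        · rw [← ENNReal.inv_pow]
          gcongr
          norm_num
        · exact tree_bound' hd hL h y i
    _ = ENNReal.ofReal 103 := by
        rw [ENNReal.tsum_mul_right, ENNReal.tsum_geometric, ENNReal.one_sub_inv_two, inv_inv]
        norm_num

theorem lyap_drift {d L₀ n : ℕ} (hd : 3 ≤ d) (hL : 1 ≤ L₀) {x : Fin d → ℤ}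
    {𝓜 : List (Fin 2) → (Fin d → ℤ)}
    (h : ProperEmbedding d L₀ n x 𝓜) (y : Fin d → ℤ) :
    avgOp (lyap d L₀ n 𝓜) y + ENNReal.ofReal (kap d) * pot d L₀ n 𝓜 x y ≤ lyap d L₀ n 𝓜 y := by
  classical
  unfold lyap pot
  rw [avgOp_add (fun _ => 1), avgOp_one hd, avgOp_tsum, ← ENNReal.tsum_mul_left, add_assoc,
    ← ENNReal.tsum_add]
  gcongr with i
  rw [avgOp_const_mul, avgOp_tsum]
  have hLi : 1 ≤ Lnum L₀ i := by
    unfold Lnum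
    exact Nat.mul_pos hL (by positivity)
  have hLpos : (0 : ℝ) < (Lnum L₀ i : ℝ) ^ 2 := by
    have : (1 : ℝ) ≤ Lnum L₀ i := by exact_mod_cast hLi
    positivity
  have key : ENNReal.ofReal (kap d) * ((shell d L₀ n 𝓜 x i).indicator (fun _ => (1 : ℝ≥0∞)) y /
      ((Lnum L₀ i : ℝ≥0∞) ^ 2 * 3 ^ i)) ≤ ((3 : ℝ≥0∞) ^ i)⁻¹ *
      ∑' l : {l : List (Fin 2) // l.length = n - i},
        (if y ∈ Qbox (𝓜 l.1) (6 * Lnum L₀ i) then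
          ENNReal.ofReal (kap d / (Lnum L₀ i : ℝ) ^ 2) else 0) := by
    by_cases hy : y ∈ shell d L₀ n 𝓜 x i
    · obtain ⟨l, hl, hyl⟩ := shell_sub h i y hy
      have h1 := ENNReal.le_tsum (f := fun l : {l : List (Fin 2) // l.length = n - i} =>
        (if y ∈ Qbox (𝓜 l.1) (6 * Lnum L₀ i) then
          ENNReal.ofReal (kap d / (Lnum L₀ i : ℝ) ^ 2) else 0)) ⟨l, hl⟩
      simp only [hyl, if_true] at h1
      refine le_trans (le_of_eq ?_) (mul_le_mul_right h1 _)
      rw [Set.indicator_of_mem hy, ENNReal.ofReal_div_of_pos hLpos, one_div,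
        ENNReal.mul_inv (Or.inr (by simp)) (Or.inr (by simp)), ENNReal.ofReal_pow (by positivity),
        ENNReal.ofReal_natCast, div_eq_mul_inv]
      ring
    · rw [Set.indicator_of_notMem hy]
      simp
  refine (add_le_add_right key _).trans ?_
  rw [← mul_add, ← ENNReal.tsum_add]
  gcongr with l
  exact drift hd _ hLi (𝓜 l.1) y

theorem exp_drift (H κ : ℝ) (hH : 0 < H) (hκ : 0 < κ) (a h v : ℝ≥0∞)
    (hle : h ≤ ENNReal.ofReal H) (hd : a + ENNReal.ofReal κ * v ≤ h) :
    eexp (ENNReal.ofReal (κ / H) * v) * a ≤ h := by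
  have hfin : h ≠ ⊤ := ne_top_of_le_ne_top ENNReal.ofReal_ne_top hle
  have ha : a ≠ ⊤ := ne_top_of_le_ne_top hfin (le_self_add.trans hd)
  have hv : v ≠ ⊤ := by
    rintro rfl
    rw [ENNReal.mul_top (by simpa using hκ), add_top] at hd
    exact hfin (top_le_iff.1 hd)
  lift h to NNReal using hfin
  lift a to NNReal using ha
  lift v to NNReal using hv
  have hle' : (h : ℝ) ≤ H := by
    have := ENNReal.toReal_mono ENNReal.ofReal_ne_top hle
    rwa [ENNReal.toReal_ofReal hH.le] at this
  have hd' : (a : ℝ) + κ * v ≤ h := by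
    have := ENNReal.toReal_mono ENNReal.coe_ne_top hd
    rw [ENNReal.toReal_add (by simp) (ENNReal.mul_ne_top (by simp) (by simp)),
      ENNReal.toReal_mul, ENNReal.toReal_ofReal hκ.le] at this
    simpa using this
  have hne : ENNReal.ofReal (κ / H) * v ≠ ⊤ := ENNReal.mul_ne_top (by simp) (by simp)
  unfold eexp
  rw [if_neg hne, ENNReal.toReal_mul, ENNReal.toReal_ofReal (by positivity), ENNReal.coe_toReal]
  rw [← ENNReal.ofReal_coe_nnreal (p := a), ← ENNReal.ofReal_coe_nnreal (p := h),
    ← ENNReal.ofReal_mul (Real.exp_pos _).le]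
  refine ENNReal.ofReal_le_ofReal ?_
  set s := κ / H * (v : ℝ) with hs
  have h1 : (a : ℝ) ≤ h * (1 - s) := by
    have : (h : ℝ) * s ≤ κ * v := by
      rw [hs]
      calc (h : ℝ) * (κ / H * v) ≤ H * (κ / H * v) := by gcongr
        _ = κ * v := by field_simp
    linarith
  have h2 : 1 - s ≤ Real.exp (-s) := by have := Real.add_one_le_exp (-s); linarith
  calc Real.exp s * a ≤ Real.exp s * (h * Real.exp (-s)) := by
        gcongr
        exact h1.trans (by gcongr)
    _ = h * (Real.exp s * Real.exp (-s)) := by ring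
    _ = h := by rw [← Real.exp_add]; simp

/-- For simple random walk on `ℤ^d`, `d ≥ 3`, there is `ε > 0` such that,
uniformly over the starting point `z` and over `L₀ ≥ 1` (and over the
hierarchical shell structure), `E_z[exp(ε Σ_i τ_i/(L_i² 3^i))] < ∞`,
where `τ_i` is the total time spent in the shell `𝓢_i`. -/
theorem stmt4 (d : ℕ) (hd : 3 ≤ d) :
    ∃ ε : ℝ, 0 < ε ∧ ∃ C : ℝ, 0 < C ∧
      ∀ (L₀ : ℕ), 1 ≤ L₀ → ∀ (n : ℕ) (x : Fin d → ℤ)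
        (𝓜 : List (Fin 2) → (Fin d → ℤ)), ProperEmbedding d L₀ n x 𝓜 →
      ∀ (z : Fin d → ℤ) (Ω : Type) (_ : MeasurableSpace Ω) (P : Measure Ω)
        (_ : IsProbabilityMeasure P) (S : ℕ → Ω → (Fin d → ℤ)),
        IsSRW P z S →
        ∫⁻ ω, eexp (ENNReal.ofReal ε *
            ∑' i : ℕ, occTime S (shell d L₀ n 𝓜 x i) ω /
              ((Lnum L₀ i : ℝ≥0∞) ^ 2 * 3 ^ i)) ∂P
          ≤ ENNReal.ofReal C := by
  refine ⟨kap d / 103, div_pos (kap_pos d) (by norm_num), 103, by norm_num, ?_⟩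
  intro L₀ hL n x 𝓜 hM z Ω _ P _ S hS
  have e : ∀ ω, ENNReal.ofReal (kap d / 103) *
      ∑' i : ℕ, occTime S (shell d L₀ n 𝓜 x i) ω / ((Lnum L₀ i : ℝ≥0∞) ^ 2 * 3 ^ i) =
      ∑' k, ENNReal.ofReal (kap d / 103) * pot d L₀ n 𝓜 x (S k ω) := by
    intro ω
    rw [ENNReal.tsum_mul_left]
    congr 1
    unfold pot occTime
    simp only [div_eq_mul_inv]
    rw [ENNReal.tsum_comm]
    refine tsum_congr fun i => ?_
    rw [ENNReal.tsum_mul_right]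
  simp_rw [e]
  refine (exp_bound hS (avgOp_one hd)
    (fun y => ENNReal.ofReal (kap d / 103) * pot d L₀ n 𝓜 x y) (lyap d L₀ n 𝓜) ?_ ?_).trans
    (lyap_le hd hL hM z)
  · intro y
    exact le_self_add
  · intro y
    exact exp_drift 103 (kap d) (by norm_num) (kap_pos d) _ _ _ (lyap_le hd hL hM y)
      (lyap_drift hd hL hM y)
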